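/- Let (c, ρ, θ, u) be a smooth classical solution of the mesoscopic two-phase Navier–Stokes system on [0,T], spatially 1-periodic, with 0 ≤ c ≤ 1, ρ̲ ≤ ρ ≤ ρ̄ for constants 0 < ρ̲ ≤ ρ̄, θ > 0, and σ = μ(c)∂ₓu − (γ(c)−1)ρθ. Assume the bounds: sup_t ∫₀¹σ² + ∫₀ᵀ∫₀¹(∂ₓσ)² ≤ C₅, ∫₀ᵀ‖∂ₓu‖_{L^∞}² ≤ C₉, and the weighted bound min(1,t)∫₀¹(∂ₓσ(t))² + ∫₀ᵗmin(1,s)∫₀¹(D_tσ)² ≤ C₁₁ for all t. Assume moreover that ∫₀¹|σ(0,x)|^{2+η} dx < ∞ for some η > 0. Then ∫₀ᵀ ‖∂ₓσ(t,·)‖_{L^∞(0,1)} dt < ∞ and ∫₀ᵀ ‖∂ₓ(σ(t,·)²)‖_{L^∞(0,1)} dt < ∞, with bounds depending only on μ_±, γ_±, c_{v,±}, ρ̲, ρ̄, T, η, C₅, C₉, C₁₁ and ∫₀¹|σ(0,x)|^{2+η}dx. -/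

import Mathlib

open Set Function MeasureTheory intervalIntegral

/-- Partial derivative in time of a function of `(t, x)`. -/
noncomputable def pdt (f : ℝ → ℝ → ℝ) (t x : ℝ) : ℝ := deriv (fun s => f s x) t

/-- Partial derivative in space of a function of `(t, x)`. -/
noncomputable def pdx (f : ℝ → ℝ → ℝ) (t x : ℝ) : ℝ := deriv (fun y => f t y) x

/-- Affine interpolation of a coefficient between the two phases:
`aff a b c = c·a + (1−c)·b` (so `μ(c) = aff μ₊ μ₋ c`, etc.). -/
def affc (a b s : ℝ) : ℝ := s * a + (1 - s) * b

/-- Cauchy stress `σ = μ(c)∂ₓu − (γ(c)−1)ρθ` of the mesoscopic two-phase model. -/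
noncomputable def sigm (μp μm γp γm : ℝ) (c ρ θ u : ℝ → ℝ → ℝ) (t x : ℝ) : ℝ :=
  affc μp μm (c t x) * pdx u t x - (affc γp γm (c t x) - 1) * ρ t x * θ t x

/-- Specific total energy `E = u²/2 + c_v(c)θ`. -/
noncomputable def Etot (kp km : ℝ) (c θ u : ℝ → ℝ → ℝ) (t x : ℝ) : ℝ :=
  u t x ^ 2 / 2 + affc kp km (c t x) * θ t x

/-- Admissible constants: `μ_± > 0`, `γ_± > 1`, `c_{v,±} > 0`. -/
def GoodConsts (μp μm γp γm kp km : ℝ) : Prop :=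
  0 < μp ∧ 0 < μm ∧ 1 < γp ∧ 1 < γm ∧ 0 < kp ∧ 0 < km

/-- The mesoscopic two-phase Navier–Stokes system on the one-dimensional torus:
spatial 1-periodicity together with the transport, mass, momentum and total
energy equations, satisfied pointwise on `[0,T] × ℝ`. -/
def MesoEqns (μp μm γp γm kp km T : ℝ) (c ρ θ u : ℝ → ℝ → ℝ) : Prop :=
  (∀ t x : ℝ, c t (x + 1) = c t x) ∧ (∀ t x : ℝ, ρ t (x + 1) = ρ t x) ∧
  (∀ t x : ℝ, θ t (x + 1) = θ t x) ∧ (∀ t x : ℝ, u t (x + 1) = u t x) ∧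
  (∀ t ∈ Icc (0:ℝ) T, ∀ x : ℝ, pdt c t x + u t x * pdx c t x = 0) ∧
  (∀ t ∈ Icc (0:ℝ) T, ∀ x : ℝ,
    pdt ρ t x + pdx (fun s y => ρ s y * u s y) t x = 0) ∧
  (∀ t ∈ Icc (0:ℝ) T, ∀ x : ℝ,
    pdt (fun s y => ρ s y * u s y) t x + pdx (fun s y => ρ s y * u s y ^ 2) t x
      = pdx (sigm μp μm γp γm c ρ θ u) t x) ∧
  (∀ t ∈ Icc (0:ℝ) T, ∀ x : ℝ,
    pdt (fun s y => ρ s y * Etot kp km c θ u s y) t x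
      + pdx (fun s y => ρ s y * Etot kp km c θ u s y * u s y) t x
      = pdx (fun s y => sigm μp μm γp γm c ρ θ u s y * u s y) t x)


lemma hasDerivAt_pdx' {f : ℝ → ℝ → ℝ} (hf : ContDiff ℝ (⊤ : ℕ∞) (uncurry f)) (t x : ℝ) :
    HasDerivAt (fun y => f t y) (fderiv ℝ (uncurry f) (t, x) (0, 1)) x := by
  have h1 : HasFDerivAt (uncurry f) (fderiv ℝ (uncurry f) (t, x)) (t, x) :=
    (hf.differentiable (by simp) _).hasFDerivAt
  have h2 : HasDerivAt (fun y : ℝ => (t, y)) ((0:ℝ), (1:ℝ)) x :=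
    (hasDerivAt_const x t).prodMk (hasDerivAt_id x)
  exact h1.comp_hasDerivAt x h2

lemma hasDerivAt_pdt' {f : ℝ → ℝ → ℝ} (hf : ContDiff ℝ (⊤ : ℕ∞) (uncurry f)) (t x : ℝ) :
    HasDerivAt (fun s => f s x) (fderiv ℝ (uncurry f) (t, x) (1, 0)) t := by
  have h1 : HasFDerivAt (uncurry f) (fderiv ℝ (uncurry f) (t, x)) (t, x) :=
    (hf.differentiable (by simp) _).hasFDerivAt
  have h2 : HasDerivAt (fun y : ℝ => (y, x)) ((1:ℝ), (0:ℝ)) t :=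
    (hasDerivAt_id t).prodMk (hasDerivAt_const t x)
  exact h1.comp_hasDerivAt t h2

lemma pdx_eq {f : ℝ → ℝ → ℝ} (hf : ContDiff ℝ (⊤ : ℕ∞) (uncurry f)) (t x : ℝ) :
    pdx f t x = fderiv ℝ (uncurry f) (t, x) (0, 1) := (hasDerivAt_pdx' hf t x).deriv

lemma pdt_eq {f : ℝ → ℝ → ℝ} (hf : ContDiff ℝ (⊤ : ℕ∞) (uncurry f)) (t x : ℝ) :
    pdt f t x = fderiv ℝ (uncurry f) (t, x) (1, 0) := (hasDerivAt_pdt' hf t x).deriv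

lemma hdx {f : ℝ → ℝ → ℝ} (hf : ContDiff ℝ (⊤ : ℕ∞) (uncurry f)) (t x : ℝ) :
    HasDerivAt (fun y => f t y) (pdx f t x) x := by
  rw [pdx_eq hf]; exact hasDerivAt_pdx' hf t x

lemma hdt {f : ℝ → ℝ → ℝ} (hf : ContDiff ℝ (⊤ : ℕ∞) (uncurry f)) (t x : ℝ) :
    HasDerivAt (fun s => f s x) (pdt f t x) t := by
  rw [pdt_eq hf]; exact hasDerivAt_pdt' hf t x

lemma smooth_dir {F : ℝ × ℝ → ℝ} (hf : ContDiff ℝ (⊤ : ℕ∞) F) (v : ℝ × ℝ) :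
    ContDiff ℝ (⊤ : ℕ∞) (fun p => fderiv ℝ F p v) := by
  have : ContDiff ℝ (⊤ : ℕ∞) (fderiv ℝ F) := hf.fderiv_right (by simp)
  exact this.clm_apply contDiff_const

lemma smooth_pdx {f : ℝ → ℝ → ℝ} (hf : ContDiff ℝ (⊤ : ℕ∞) (uncurry f)) :
    ContDiff ℝ (⊤ : ℕ∞) (uncurry (pdx f)) := by
  have : uncurry (pdx f) = fun p => fderiv ℝ (uncurry f) p (0, 1) := by
    ext ⟨t, x⟩; exact pdx_eq hf t x
  rw [this]; exact smooth_dir hf _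

lemma smooth_pdt {f : ℝ → ℝ → ℝ} (hf : ContDiff ℝ (⊤ : ℕ∞) (uncurry f)) :
    ContDiff ℝ (⊤ : ℕ∞) (uncurry (pdt f)) := by
  have : uncurry (pdt f) = fun p => fderiv ℝ (uncurry f) p (1, 0) := by
    ext ⟨t, x⟩; exact pdt_eq hf t x
  rw [this]; exact smooth_dir hf _

lemma pdt_pdx {f : ℝ → ℝ → ℝ} (hf : ContDiff ℝ (⊤ : ℕ∞) (uncurry f)) (t x : ℝ) :
    pdt (pdx f) t x = pdx (pdt f) t x := by
  have hx : uncurry (pdx f) = fun p => fderiv ℝ (uncurry f) p (0, 1) := by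
    ext ⟨t, x⟩; exact pdx_eq hf t x
  have ht : uncurry (pdt f) = fun p => fderiv ℝ (uncurry f) p (1, 0) := by
    ext ⟨t, x⟩; exact pdt_eq hf t x
  rw [pdt_eq (smooth_pdx hf), pdx_eq (smooth_pdt hf), hx, ht]
  have hd : ContDiff ℝ (⊤ : ℕ∞) (fderiv ℝ (uncurry f)) := hf.fderiv_right (by simp)
  have h1 : HasFDerivAt (fderiv ℝ (uncurry f)) (fderiv ℝ (fderiv ℝ (uncurry f)) (t, x)) (t, x) :=
    (hd.differentiable (by simp) _).hasFDerivAt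
  have hs := second_derivative_symmetric (𝕜 := ℝ) (f := uncurry f)
    (fun y => (hf.differentiable (by simp) y).hasFDerivAt) h1 (1, 0) (0, 1)
  have e : ∀ v w : ℝ × ℝ, fderiv ℝ (fun p => fderiv ℝ (uncurry f) p v) (t, x) w
      = fderiv ℝ (fderiv ℝ (uncurry f)) (t, x) w v := by
    intro v w
    have := h1.clm_apply (hasFDerivAt_const v (t, x))
    rw [this.fderiv]; simp
  rw [e, e]; exact hs

lemma smooth_sigm (μp μm γp γm : ℝ) {c ρ θ u : ℝ → ℝ → ℝ}
    (hc : ContDiff ℝ (⊤ : ℕ∞) (uncurry c)) (hr : ContDiff ℝ (⊤ : ℕ∞) (uncurry ρ))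
    (hθ : ContDiff ℝ (⊤ : ℕ∞) (uncurry θ)) (hu : ContDiff ℝ (⊤ : ℕ∞) (uncurry u)) :
    ContDiff ℝ (⊤ : ℕ∞) (uncurry (sigm μp μm γp γm c ρ θ u)) := by
  have hux := smooth_pdx hu
  have : uncurry (sigm μp μm γp γm c ρ θ u) = fun p =>
    (uncurry c p * μp + (1 - uncurry c p) * μm) * uncurry (pdx u) p
     - ((uncurry c p * γp + (1 - uncurry c p) * γm) - 1) * uncurry ρ p * uncurry θ p := by
    ext ⟨t, x⟩; rfl
  rw [this]; fun_prop

/-- periodicity of the space derivative -/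
lemma pdx_per {f : ℝ → ℝ → ℝ} (h : ∀ t x : ℝ, f t (x + 1) = f t x) (t x : ℝ) :
    pdx f t (x + 1) = pdx f t x := by
  unfold pdx
  rw [← deriv_comp_add_const]
  congr 1; ext y; exact h t y

lemma pdt_per {f : ℝ → ℝ → ℝ} (h : ∀ t x : ℝ, f t (x + 1) = f t x) (t x : ℝ) :
    pdt f t (x + 1) = pdt f t x := by
  unfold pdt
  congr 1; ext s; exact h s x

/-- Momentum equation in Lagrangian form. -/
lemma momentum_eq {μp μm γp γm kp km T : ℝ} {c ρ θ u : ℝ → ℝ → ℝ}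
    (hr : ContDiff ℝ (⊤ : ℕ∞) (uncurry ρ)) (hu : ContDiff ℝ (⊤ : ℕ∞) (uncurry u))
    (hE : MesoEqns μp μm γp γm kp km T c ρ θ u) (t : ℝ) (ht : t ∈ Icc (0:ℝ) T) (x : ℝ) :
    ρ t x * (pdt u t x + u t x * pdx u t x) = pdx (sigm μp μm γp γm c ρ θ u) t x := by
  obtain ⟨-, -, -, -, -, hm, hmo, -⟩ := hE
  have h1 := hm t ht x
  have h2 := hmo t ht x
  have e1 : pdx (fun s y => ρ s y * u s y) t x = pdx ρ t x * u t x + ρ t x * pdx u t x :=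
    ((hdx hr t x).mul (hdx hu t x)).deriv
  have e2 : pdt (fun s y => ρ s y * u s y) t x = pdt ρ t x * u t x + ρ t x * pdt u t x :=
    ((hdt hr t x).mul (hdt hu t x)).deriv
  have e3 : pdx (fun s y => ρ s y * u s y ^ 2) t x
      = pdx ρ t x * u t x ^ 2 + ρ t x * (2 * u t x * pdx u t x) := by
    have := ((hdx hr t x).mul ((hdx hu t x).pow 2)).deriv
    refine Eq.trans ?_ (this.trans ?_)
    · rfl
    · simp
  rw [e1] at h1
  rw [e2, e3] at h2
  linear_combination h2 - u t x * h1

/-- The evolution equation for the stress. -/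
lemma stress_eq {μp μm γp γm kp km T : ℝ} {c ρ θ u : ℝ → ℝ → ℝ}
    (hc : ContDiff ℝ (⊤ : ℕ∞) (uncurry c)) (hr : ContDiff ℝ (⊤ : ℕ∞) (uncurry ρ))
    (hθ : ContDiff ℝ (⊤ : ℕ∞) (uncurry θ)) (hu : ContDiff ℝ (⊤ : ℕ∞) (uncurry u))
    (hE : MesoEqns μp μm γp γm kp km T c ρ θ u) (t : ℝ) (ht : t ∈ Icc (0:ℝ) T) (x : ℝ)
    (_hρ : ρ t x ≠ 0) :
    affc kp km (c t x) * (pdt (sigm μp μm γp γm c ρ θ u) t x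
        + u t x * pdx (sigm μp μm γp γm c ρ θ u) t x)
      = affc kp km (c t x) * affc μp μm (c t x) *
          pdx (fun s y => pdt u s y + u s y * pdx u s y) t x
        - (affc kp km (c t x) + affc γp γm (c t x) - 1) *
            (sigm μp μm γp γm c ρ θ u t x * pdx u t x) := by
  have hM := momentum_eq hr hu hE t ht x
  obtain ⟨-, -, -, -, htr, hm, -, hen⟩ := hE
  have h1 := hm t ht x
  have h0 := htr t ht x
  have h3 := hen t ht x
  have hux := smooth_pdx hu
  have hσ := smooth_sigm μp μm γp γm hc hr hθ hu
  have e1 : pdx (fun s y => ρ s y * u s y) t x = pdx ρ t x * u t x + ρ t x * pdx u t x :=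
    ((hdx hr t x).mul (hdx hu t x)).deriv
  have aft : ∀ a b : ℝ, HasDerivAt (fun s => affc a b (c s x)) (pdt c t x * (a - b)) t := by
    intro a b
    unfold affc
    refine (((hdt hc t x).mul_const a).add (((hdt hc t x).const_sub 1).mul_const b)).congr_deriv ?_
    ring
  have afx : ∀ a b : ℝ, HasDerivAt (fun s => affc a b (c t s)) (pdx c t x * (a - b)) x := by
    intro a b
    unfold affc
    refine (((hdx hc t x).mul_const a).add (((hdx hc t x).const_sub 1).mul_const b)).congr_deriv ?_
    ring
  have Et : HasDerivAt (fun s => Etot kp km c θ u s x) (u t x * pdt u t x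
      + (pdt c t x * (kp - km) * θ t x + affc kp km (c t x) * pdt θ t x)) t := by
    refine ((((hdt hu t x).pow 2).div_const 2).add ((aft kp km).mul (hdt hθ t x))).congr_deriv ?_
    simp; ring
  have Ex : HasDerivAt (fun s => Etot kp km c θ u t s) (u t x * pdx u t x
      + (pdx c t x * (kp - km) * θ t x + affc kp km (c t x) * pdx θ t x)) x := by
    refine ((((hdx hu t x).pow 2).div_const 2).add ((afx kp km).mul (hdx hθ t x))).congr_deriv ?_
    simp; ring
  have e2 := ((hdt hr t x).mul Et).deriv
  have e3 := (((hdx hr t x).mul Ex).mul (hdx hu t x)).deriv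
  have e4 := ((hdx hσ t x).mul (hdx hu t x)).deriv
  have st := (((aft μp μm).mul (hdt hux t x)).sub
    ((((aft γp γm).sub_const 1).mul (hdt hr t x)).mul (hdt hθ t x))).deriv
  have sx := (((afx μp μm).mul (hdx hux t x)).sub
    ((((afx γp γm).sub_const 1).mul (hdx hr t x)).mul (hdx hθ t x))).deriv
  have ev := ((hdx (smooth_pdt hu) t x).add ((hdx hu t x).mul (hdx hux t x))).deriv
  have hsym := pdt_pdx hu t x
  change pdt (sigm μp μm γp γm c ρ θ u) t x = _ at st
  change pdx (sigm μp μm γp γm c ρ θ u) t x = _ at sx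
  change pdx (fun s y => pdt u s y + u s y * pdx u s y) t x = _ at ev
  change pdt (fun s y => ρ s y * Etot kp km c θ u s y) t x = _ at e2
  change pdx (fun s y => ρ s y * Etot kp km c θ u s y * u s y) t x = _ at e3
  change pdx (fun s y => sigm μp μm γp γm c ρ θ u s y * u s y) t x = _ at e4
  rw [e1] at h1
  rw [e2, e3, e4, ← hM] at h3
  have hΘ : ρ t x * affc kp km (c t x) * (pdt θ t x + u t x * pdx θ t x)
      = sigm μp μm γp γm c ρ θ u t x * pdx u t x := by
    simp only [Pi.mul_apply] at h3
    linear_combination h3 - Etot kp km c θ u t x * h1 - ρ t x * (kp - km) * θ t x * h0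
  have hΘ' := hΘ
  rw [st, sx, ev, ← hsym]
  have hsd : sigm μp μm γp γm c ρ θ u t x = affc μp μm (c t x) * pdx u t x
    - (affc γp γm (c t x) - 1) * ρ t x * θ t x := rfl
  generalize hKK : affc kp km (c t x) = K at *
  simp only [Pi.mul_apply]
  linear_combination K * ((μp - μm) * pdx u t x - (γp - γm) * ρ t x * θ t x) * h0
    - K * (affc γp γm (c t x) - 1) * θ t x * h1 - (affc γp γm (c t x) - 1) * hΘ
    + K * pdx u t x * hsd

/-- sup over `[0,1]` -/
noncomputable def supn (f : ℝ → ℝ → ℝ) (t : ℝ) : ℝ := ⨆ x : Icc (0:ℝ) 1, |f t x.1|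

lemma supn_cont {f : ℝ → ℝ → ℝ} (hf : Continuous (uncurry f)) : Continuous (supn f) := by
  have h := IsCompact.continuous_sSup (f := fun t x => |f t x|) (isCompact_Icc (a := (0:ℝ)) (b := 1))
    (by exact hf.abs)
  have e : supn f = fun t => sSup ((fun x => |f t x|) '' Icc (0:ℝ) 1) := by
    ext t; unfold supn; rw [sSup_image']
  rw [e]; exact h

lemma cont_slice {f : ℝ → ℝ → ℝ} (hf : Continuous (uncurry f)) (t : ℝ) :
    Continuous (fun x => f t x) := hf.comp (by fun_prop : Continuous fun x : ℝ => (t, x))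

lemma cont_slice' {f : ℝ → ℝ → ℝ} (hf : Continuous (uncurry f)) (x : ℝ) :
    Continuous (fun t => f t x) := hf.comp (by fun_prop : Continuous fun t : ℝ => (t, x))

lemma le_supn {f : ℝ → ℝ → ℝ} (hf : Continuous (uncurry f)) (t : ℝ) {x : ℝ}
    (hx : x ∈ Icc (0:ℝ) 1) : |f t x| ≤ supn f t := by
  have hb : BddAbove (range fun x : Icc (0:ℝ) 1 => |f t x.1|) := by
    have := (isCompact_Icc (a := (0:ℝ)) (b := 1)).bddAbove_image
      ((cont_slice hf t).abs.continuousOn)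
    rw [image_eq_range] at this
    exact this
  exact le_ciSup hb ⟨x, hx⟩

instance nonempty_Icc01 : Nonempty (Icc (0:ℝ) 1) := ⟨⟨0, by simp⟩⟩

lemma supn_le {f : ℝ → ℝ → ℝ} {t b : ℝ} (h : ∀ x ∈ Icc (0:ℝ) 1, |f t x| ≤ b) :
    supn f t ≤ b := ciSup_le fun x => h x.1 x.2

lemma supn_nonneg {f : ℝ → ℝ → ℝ} (t : ℝ) : 0 ≤ supn f t :=
  Real.iSup_nonneg fun _ => abs_nonneg _

lemma cont_int {f : ℝ → ℝ → ℝ} (hf : Continuous (uncurry f)) :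
    Continuous (fun t => ∫ x in (0:ℝ)..1, f t x) :=
  continuous_parametric_intervalIntegral_of_continuous' hf 0 1

/-- Integrated differentiation under the integral sign. -/
lemma int_diff {F G : ℝ → ℝ → ℝ} {T : ℝ} (hG : Continuous (uncurry G))
    (hF : ∀ t ∈ Icc (0:ℝ) T, Continuous (F t))
    (hd : ∀ t ∈ Icc (0:ℝ) T, ∀ x, HasDerivAt (fun s => F s x) (G t x) t)
    (t : ℝ) (ht : t ∈ Icc (0:ℝ) T) :
    (∫ x in (0:ℝ)..1, F t x) = (∫ x in (0:ℝ)..1, F 0 x)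
      + ∫ s in (0:ℝ)..t, ∫ x in (0:ℝ)..1, G s x := by
  have h0 : (0:ℝ) ∈ Icc (0:ℝ) T := ⟨le_rfl, ht.1.trans ht.2⟩
  have h1 : ∀ x, F t x - F 0 x = ∫ s in (0:ℝ)..t, G s x := by
    intro x
    symm
    apply integral_eq_sub_of_hasDerivAt
    · intro s hs
      rw [uIcc_of_le ht.1] at hs
      exact hd s ⟨hs.1, hs.2.trans ht.2⟩ x
    · exact (cont_slice' hG x).intervalIntegrable _ _
  rw [intervalIntegral_intervalIntegral_swap]
  · simp_rw [← h1]
    rw [integral_sub ((hF t ht).intervalIntegrable _ _) ((hF 0 h0).intervalIntegrable _ _)]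
    ring
  · have : IntegrableOn (uncurry G) (uIcc 0 t ×ˢ uIcc 0 1) :=
      hG.continuousOn.integrableOn_compact (isCompact_uIcc.prod isCompact_uIcc)
    exact this.mono_set (prod_mono uIoc_subset_uIcc uIoc_subset_uIcc)

/-- Gronwall with dissipation. -/
lemma gronwall_diss {h a D y : ℝ → ℝ} {T K δ y0 : ℝ} (hT : 0 ≤ T) (hh : Continuous h)
    (ha : Continuous a) (hD : Continuous D) (hK : 0 ≤ K) (hδ : 0 ≤ δ)
    (ha0 : ∀ t, 0 ≤ a t) (hD0 : ∀ t, 0 ≤ D t)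
    (hy : ∀ t ∈ Icc (0:ℝ) T, y t = y0 + ∫ s in (0:ℝ)..t, h s)
    (hy0 : ∀ t ∈ Icc (0:ℝ) T, 0 ≤ y t)
    (hle : ∀ t ∈ Icc (0:ℝ) T, h t ≤ K * a t * y t - δ * D t) :
    (∀ t ∈ Icc (0:ℝ) T, y t ≤ y0 * Real.exp (K * ∫ s in (0:ℝ)..T, a s)) ∧
    δ * (∫ s in (0:ℝ)..T, D s) ≤ y0 * Real.exp (K * ∫ s in (0:ℝ)..T, a s) := by
  set A : ℝ → ℝ := fun t => ∫ s in (0:ℝ)..t, a s with hA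
  have hAd : ∀ t, HasDerivAt A (a t) t := fun t =>
    ha.integral_hasStrictDerivAt 0 t |>.hasDerivAt
  have hAc : Continuous A := continuous_iff_continuousAt.2 fun t => (hAd t).continuousAt
  have hAmono : Monotone A := monotone_of_hasDerivAt_nonneg hAd (fun t => ha0 t)
  set Y : ℝ → ℝ := fun t => y0 + ∫ s in (0:ℝ)..t, h s with hY
  have hYd : ∀ t, HasDerivAt Y (h t) t := fun t =>
    (hh.integral_hasStrictDerivAt 0 t |>.hasDerivAt).const_add y0
  have hE : ∀ t, HasDerivAt (fun t => Real.exp (-(K * A t))) (Real.exp (-(K * A t)) * -(K * a t)) t :=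
    fun t => (((hAd t).const_mul K).neg).exp
  have hEc : Continuous (fun t => D t * Real.exp (-(K * A t))) := by fun_prop
  set z : ℝ → ℝ := fun t => Y t * Real.exp (-(K * A t))
    + δ * ∫ s in (0:ℝ)..t, D s * Real.exp (-(K * A s)) with hz
  have hzd : ∀ t, HasDerivAt z ((h t * Real.exp (-(K * A t)) +
      Y t * (Real.exp (-(K * A t)) * -(K * a t))) + δ * (D t * Real.exp (-(K * A t)))) t :=
    fun t => ((hYd t).mul (hE t)).add
      ((hEc.integral_hasStrictDerivAt 0 t |>.hasDerivAt).const_mul δ)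
  have hanti : AntitoneOn z (Icc 0 T) := by
    apply antitoneOn_of_deriv_nonpos (convex_Icc 0 T)
    · exact fun t _ => (hzd t).continuousAt.continuousWithinAt
    · exact fun t _ => (hzd t).differentiableAt.differentiableWithinAt
    · intro t ht
      rw [interior_Icc] at ht
      have ht' : t ∈ Icc (0:ℝ) T := ⟨ht.1.le, ht.2.le⟩
      rw [(hzd t).deriv]
      have h1 := hle t ht'
      rw [hy t ht'] at h1
      change h t ≤ K * a t * Y t - δ * D t at h1
      have := Real.exp_pos (-(K * A t))
      nlinarith
  have hA0 : A 0 = 0 := by simp [hA]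
  have hz0 : z 0 = y0 := by simp [hz, hY, hA0]
  have hkey : ∀ t ∈ Icc (0:ℝ) T, z t ≤ y0 := fun t ht =>
    hz0 ▸ hanti ⟨le_rfl, hT⟩ ht ht.1
  have hDint : ∀ t ∈ Icc (0:ℝ) T, 0 ≤ ∫ s in (0:ℝ)..t, D s * Real.exp (-(K * A s)) :=
    fun t ht => intervalIntegral.integral_nonneg ht.1
      fun s _ => mul_nonneg (hD0 s) (Real.exp_pos _).le
  have hTT : T ∈ Icc (0:ℝ) T := ⟨hT, le_rfl⟩
  have hee : ∀ r : ℝ, Real.exp r * Real.exp (-r) = 1 := fun r => by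
    rw [← Real.exp_add]; simp
  have hy00 : 0 ≤ y0 := by
    have := hy0 0 ⟨le_rfl, hT⟩
    rw [hy 0 ⟨le_rfl, hT⟩] at this; simpa using this
  constructor
  · intro t ht
    have h1 := hkey t ht
    have h2 : Y t * Real.exp (-(K * A t)) ≤ y0 := by
      have := mul_nonneg hδ (hDint t ht)
      simp only [hz] at h1; linarith
    have h3 : Y t ≤ y0 * Real.exp (K * A t) := by
      calc Y t = (Y t * Real.exp (-(K * A t))) * Real.exp (K * A t) := by
            rw [mul_assoc, mul_comm (Real.exp _), hee, mul_one]
        _ ≤ _ := mul_le_mul_of_nonneg_right h2 (Real.exp_pos _).le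
    rw [hy t ht]
    refine h3.trans (mul_le_mul_of_nonneg_left (Real.exp_le_exp.2 ?_) hy00)
    exact mul_le_mul_of_nonneg_left (hAmono ht.2) hK
  · have h1 := hkey T hTT
    have hYT : 0 ≤ Y T := by
      have := hy0 T hTT
      rwa [hy T hTT] at this
    have h2 : δ * (∫ s in (0:ℝ)..T, D s * Real.exp (-(K * A s))) ≤ y0 := by
      have := mul_nonneg hYT (Real.exp_pos (-(K * A T))).le
      simp only [hz] at h1; linarith
    have h3 : (∫ s in (0:ℝ)..T, D s) * Real.exp (-(K * A T))
        ≤ ∫ s in (0:ℝ)..T, D s * Real.exp (-(K * A s)) := by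
      rw [← intervalIntegral.integral_mul_const]
      apply integral_mono_on hT
      · exact (by fun_prop : Continuous fun s => D s * Real.exp (-(K * A T))).intervalIntegrable _ _
      · exact hEc.intervalIntegrable _ _
      · intro s hs
        apply mul_le_mul_of_nonneg_left _ (hD0 s)
        apply Real.exp_le_exp.2
        have := mul_le_mul_of_nonneg_left (hAmono hs.2) hK
        linarith
    calc δ * (∫ s in (0:ℝ)..T, D s)
        = δ * ((∫ s in (0:ℝ)..T, D s) * Real.exp (-(K * A T))) * Real.exp (K * A T) := by
          rw [mul_assoc δ, mul_assoc, mul_comm (Real.exp _), hee, mul_one]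
      _ ≤ y0 * Real.exp (K * A T) := by
          apply mul_le_mul_of_nonneg_right _ (Real.exp_pos _).le
          exact (mul_le_mul_of_nonneg_left h3 hδ).trans h2

/-- oscillation bound -/
lemma osc_bound {f f' : ℝ → ℝ} (hf : ∀ x, HasDerivAt f (f' x) x) (hf' : Continuous f')
    {x y : ℝ} (hx : x ∈ Icc (0:ℝ) 1) (hy : y ∈ Icc (0:ℝ) 1) :
    f x - f y ≤ ∫ z in (0:ℝ)..1, |f' z| := by
  have h1 : ∫ z in y..x, f' z = f x - f y :=
    integral_eq_sub_of_hasDerivAt (fun z _ => hf z) (hf'.intervalIntegrable _ _)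
  rw [← h1]
  refine (le_abs_self _).trans ((norm_integral_le_integral_norm_uIoc (f := f')).trans ?_)
  simp only [Real.norm_eq_abs]
  rw [integral_of_le zero_le_one]
  apply setIntegral_mono_set
  · exact (hf'.abs.intervalIntegrable 0 1).1
  · exact Filter.Eventually.of_forall fun z => abs_nonneg _
  · apply LE.le.eventuallyLE
    intro z hz
    rw [uIoc] at hz
    exact ⟨lt_of_le_of_lt (le_min hy.1 hx.1) hz.1, hz.2.trans (max_le hy.2 hx.2)⟩

lemma sup_le_mean {f f' : ℝ → ℝ} (hf : ∀ x, HasDerivAt f (f' x) x) (hf' : Continuous f')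
    {x : ℝ} (hx : x ∈ Icc (0:ℝ) 1) :
    f x ≤ (∫ z in (0:ℝ)..1, f z) + ∫ z in (0:ℝ)..1, |f' z| := by
  have hc : Continuous f := continuous_iff_continuousAt.2 fun t => (hf t).continuousAt
  have : ∫ z in (0:ℝ)..1, (f x - ∫ z in (0:ℝ)..1, |f' z|) ≤ ∫ z in (0:ℝ)..1, f z := by
    apply integral_mono_on zero_le_one
    · exact intervalIntegrable_const
    · exact hc.intervalIntegrable _ _
    · intro y hy
      have := osc_bound hf hf' hx hy
      linarith
  rw [intervalIntegral.integral_const] at this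
  simp at this
  linarith

/-- Interpolation bound for a function vanishing somewhere. -/
lemma interp_bound {v v' : ℝ → ℝ} (hv : ∀ x, HasDerivAt v (v' x) x) (hv' : Continuous v')
    {x y : ℝ} (hx : x ∈ Icc (0:ℝ) 1) (hy : y ∈ Icc (0:ℝ) 1) (h0 : v y = 0) {l : ℝ} (hl : 0 < l) :
    v x ^ 2 ≤ l * (∫ z in (0:ℝ)..1, v z ^ 2) + (∫ z in (0:ℝ)..1, v' z ^ 2) / l := by
  have hc : Continuous v := continuous_iff_continuousAt.2 fun t => (hv t).continuousAt
  have hd : ∀ x, HasDerivAt (fun x => v x ^ 2) (2 * v x * v' x) x := fun x => by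
    refine ((hv x).pow 2).congr_deriv ?_
    simp
  have h1 := osc_bound hd (by fun_prop) hx hy
  simp only [h0] at h1
  have h2 : ∫ z in (0:ℝ)..1, |2 * v z * v' z| ≤ ∫ z in (0:ℝ)..1, (l * v z ^ 2 + v' z ^ 2 / l) := by
    apply integral_mono_on zero_le_one
    · exact (by fun_prop : Continuous fun z => |2 * v z * v' z|).intervalIntegrable _ _
    · exact (by fun_prop : Continuous fun z => (l * v z ^ 2 + v' z ^ 2 / l)).intervalIntegrable _ _
    · intro z _
      have e : ∀ s : ℝ, l * v z ^ 2 + v' z ^ 2 / l - 2 * v z * v' z * s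
          = (l * v z - s * v' z) ^ 2 / l + (1 - s ^ 2) * v' z ^ 2 / l := by
        intro s; field_simp; ring
      have e1 := e 1
      have e2 := e (-1)
      have p1 : 0 ≤ (l * v z - 1 * v' z) ^ 2 / l := by positivity
      have p2 : 0 ≤ (l * v z - (-1) * v' z) ^ 2 / l := by positivity
      norm_num at e1 e2 p1 p2
      rw [abs_le]; constructor <;> linarith
  rw [integral_add ((by fun_prop : Continuous fun z => l * v z ^ 2).intervalIntegrable _ _)
    ((by fun_prop : Continuous fun z => v' z ^ 2 / l).intervalIntegrable _ _),
    intervalIntegral.integral_const_mul, intervalIntegral.integral_div] at h2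
  linarith

/-- integral of a derivative of a periodic function -/
lemma int_deriv_per {P P' : ℝ → ℝ} (hP : ∀ x, HasDerivAt P (P' x) x) (hP' : Continuous P')
    (hper : P 1 = P 0) : ∫ x in (0:ℝ)..1, P' x = 0 := by
  rw [integral_eq_sub_of_hasDerivAt (fun z _ => hP z) (hP'.intervalIntegrable _ _), hper, sub_self]

/-- Final time integration. -/
lemma final_time {M W A B a D : ℝ → ℝ} {T K1 K2 K3 q C5 C9 C11 CD : ℝ} (hT : 0 < T) (hq : 2 < q)
    (hM : Continuous M) (hW : Continuous W) (hA : Continuous A) (hB : Continuous B)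
    (ha : Continuous a) (hD : Continuous D) (hK1 : 0 ≤ K1) (hK2 : 0 ≤ K2) (hK3 : 0 ≤ K3)
    (hW1 : ∀ t ∈ Icc (0:ℝ) T, 0 ≤ W t) (hB0 : ∀ t, 0 ≤ B t)
    (hMle : ∀ t ∈ Icc (0:ℝ) T, ∀ l > 0, M t ^ 2 ≤ K1 * (l * A t + (B t + K3 * a t ^ 2) / l))
    (hWle : ∀ t ∈ Icc (0:ℝ) T, W t ^ q ≤ K2 * (1 + D t))
    (iA : ∫ t in (0:ℝ)..T, A t ≤ C5) (iB : ∫ t in (0:ℝ)..T, min 1 t * B t ≤ C11)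
    (ia : ∫ t in (0:ℝ)..T, a t ^ 2 ≤ C9) (iD : ∫ t in (0:ℝ)..T, D t ≤ CD) :
    ∫ t in (0:ℝ)..T, M t * √(W t) ≤ K1 * (C5 + (1 + T) * C11 + T * K3 * C9) + K2 * (T + CD)
      + T ^ (-(q / (2 * (q - 1))) + 1) / (-(q / (2 * (q - 1))) + 1) := by
  set r : ℝ := -(q / (2 * (q - 1))) with hr
  have hr1 : -1 < r := by
    rw [hr, neg_lt_neg_iff, div_lt_one (by linarith)]; linarith
  have ir : IntervalIntegrable (fun t : ℝ => t ^ r) volume 0 T := intervalIntegrable_rpow' hr1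
  have hcont : Continuous (fun t => K1 * (A t + (1 + T) * (min 1 t * B t) + T * K3 * a t ^ 2)
    + K2 * (1 + D t)) := by fun_prop
  have key : ∫ t in (0:ℝ)..T, M t * √(W t) ≤
      ∫ t in (0:ℝ)..T, ((K1 * (A t + (1 + T) * (min 1 t * B t) + T * K3 * a t ^ 2)
        + K2 * (1 + D t)) + t ^ r) := by
    apply integral_mono_on_of_le_Ioo hT.le
    · exact (by fun_prop : Continuous fun t => M t * √(W t)).intervalIntegrable _ _
    · exact (hcont.intervalIntegrable _ _).add ir
    · intro t ht
      have ht' : t ∈ Icc (0:ℝ) T := ⟨ht.1.le, ht.2.le⟩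
      have t0 : 0 < t := ht.1
      have s0 : 0 < √t := Real.sqrt_pos.2 t0
      have hss : √t * √t = t := Real.mul_self_sqrt t0.le
      have w0 := hW1 t ht'
      have h1 : M t * √(W t) ≤ √t * M t ^ 2 + W t * (√t)⁻¹ := by
        have hw : √(W t) ^ 2 = W t := Real.sq_sqrt w0
        have : √t * M t ^ 2 + W t * (√t)⁻¹ - M t * √(W t)
          = ((√t * M t - √(W t) / 2) ^ 2 + 3 / 4 * W t) / √t := by
          field_simp
          linear_combination (-4) * hw
        have h2 : 0 ≤ ((√t * M t - √(W t) / 2) ^ 2 + 3 / 4 * W t) / √t := by positivity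
        linarith
      have h2 : √t * M t ^ 2 ≤ K1 * (A t + (1 + T) * (min 1 t * B t) + T * K3 * a t ^ 2) := by
        have := hMle t ht' (√t)⁻¹ (by positivity)
        calc √t * M t ^ 2 ≤ √t * (K1 * ((√t)⁻¹ * A t + (B t + K3 * a t ^ 2) / (√t)⁻¹)) :=
              mul_le_mul_of_nonneg_left this s0.le
          _ = K1 * (A t + (√t * √t) * (B t + K3 * a t ^ 2)) := by field_simp
          _ = K1 * (A t + t * B t + t * K3 * a t ^ 2) := by rw [hss]; ring
          _ ≤ _ := by
            apply mul_le_mul_of_nonneg_left _ hK1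
            have e1 : t ≤ (1 + T) * min 1 t := by
              rcases le_total 1 t with h | h
              · rw [min_eq_left h]; linarith [ht.2]
              · rw [min_eq_right h]; nlinarith
            have e2 := mul_le_mul_of_nonneg_right e1 (hB0 t)
            have e3 : t * K3 * a t ^ 2 ≤ T * K3 * a t ^ 2 := by
              gcongr; exact ht.2.le
            linarith
      have h3 : W t * (√t)⁻¹ ≤ K2 * (1 + D t) + t ^ r := by
        have hpq : q.HolderConjugate (q / (q - 1)) :=
          Real.HolderConjugate.conjExponent (by linarith)
        have y := Real.young_inequality_of_nonneg w0 (inv_nonneg.2 s0.le) hpq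
        have e1 : ((√t)⁻¹) ^ (q / (q - 1)) = t ^ r := by
          rw [Real.sqrt_eq_rpow, ← Real.rpow_neg t0.le, ← Real.rpow_mul t0.le]
          congr 1
          rw [hr]
          have : q - 1 ≠ 0 := by linarith
          field_simp
        rw [e1] at y
        have e2 := hWle t ht'
        have e3 : W t ^ q / q ≤ W t ^ q := div_le_self (Real.rpow_nonneg w0 _) (by linarith)
        have e4 : t ^ r / (q / (q - 1)) ≤ t ^ r :=
          div_le_self (Real.rpow_nonneg t0.le _) hpq.symm.lt.le
        linarith
      linarith
  refine key.trans ?_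
  rw [integral_add (hcont.intervalIntegrable _ _) ir]
  have e1 : ∫ t in (0:ℝ)..T, t ^ r = T ^ (r + 1) / (r + 1) := by
    rw [integral_rpow (Or.inl hr1), Real.zero_rpow (by linarith), sub_zero]
  rw [e1]
  have iiA := hA.intervalIntegrable (μ := volume) 0 T
  have iiB := (by fun_prop : Continuous fun t => (1 + T) * (min 1 t * B t)).intervalIntegrable (μ := volume) 0 T
  have iia := (by fun_prop : Continuous fun t => T * K3 * a t ^ 2).intervalIntegrable (μ := volume) 0 T
  have iiD := hD.intervalIntegrable (μ := volume) 0 T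
  rw [integral_add (((iiA.add iiB).add iia).const_mul K1)
      ((intervalIntegrable_const.add iiD).const_mul K2),
    intervalIntegral.integral_const_mul, intervalIntegral.integral_const_mul,
    integral_add (iiA.add iiB) iia, integral_add iiA iiB, integral_add intervalIntegrable_const iiD,
    intervalIntegral.integral_const_mul, intervalIntegral.integral_const_mul,
    intervalIntegral.integral_const]
  simp only [sub_zero, smul_eq_mul, mul_one]
  gcongr

noncomputable def PhiQ (q s : ℝ) : ℝ := (1 + s ^ 2) ^ (q / 2)
noncomputable def PsiQ (q s : ℝ) : ℝ := (1 + s ^ 2) ^ (q / 2 - 1)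
noncomputable def dPhiQ (q s : ℝ) : ℝ := q * s * PsiQ q s
noncomputable def ddPhiQ (q s : ℝ) : ℝ :=
  q * PsiQ q s + q * s * (2 * s * (q / 2 - 1) * (1 + s ^ 2) ^ (q / 2 - 1 - 1))

lemma PsiQ_pos (q s : ℝ) : 0 < PsiQ q s := by unfold PsiQ; positivity
lemma PhiQ_pos (q s : ℝ) : 0 < PhiQ q s := by unfold PhiQ; positivity
lemma PhiQ_eq (q s : ℝ) : PhiQ q s = PsiQ q s * (1 + s ^ 2) := by
  unfold PhiQ PsiQ
  have h : 0 < 1 + s ^ 2 := by positivity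
  conv_rhs => rw [← Real.rpow_add_one h.ne']
  congr 1; ring

lemma onesq_deriv (s : ℝ) : HasDerivAt (fun s : ℝ => 1 + s ^ 2) (2 * s) s := by
  refine (((hasDerivAt_id s).pow 2).const_add 1).congr_deriv ?_
  simp

lemma PhiQ_deriv (q s : ℝ) : HasDerivAt (PhiQ q) (dPhiQ q s) s := by
  have h : 0 < 1 + s ^ 2 := by positivity
  refine ((onesq_deriv s).rpow_const (p := q / 2) (Or.inl h.ne')).congr_deriv ?_
  unfold dPhiQ PsiQ; ring

lemma dPhiQ_deriv (q s : ℝ) : HasDerivAt (dPhiQ q) (ddPhiQ q s) s := by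
  have h : 0 < 1 + s ^ 2 := by positivity
  refine (((hasDerivAt_id s).const_mul q).mul
    ((onesq_deriv s).rpow_const (p := q / 2 - 1) (Or.inl h.ne'))).congr_deriv ?_
  unfold ddPhiQ PsiQ; simp

lemma onesq_cont (r : ℝ) : Continuous fun s : ℝ => (1 + s ^ 2) ^ r :=
  Continuous.rpow_const (by fun_prop) fun s => Or.inl (by positivity)

@[fun_prop] lemma PhiQ_cont (q : ℝ) : Continuous (PhiQ q) := onesq_cont _
@[fun_prop] lemma PsiQ_cont (q : ℝ) : Continuous (PsiQ q) := onesq_cont _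
@[fun_prop] lemma dPhiQ_cont (q : ℝ) : Continuous (dPhiQ q) :=
  continuous_iff_continuousAt.2 fun s => (dPhiQ_deriv q s).continuousAt
@[fun_prop] lemma ddPhiQ_cont (q : ℝ) : Continuous (ddPhiQ q) := by
  have := onesq_cont (q / 2 - 1 - 1)
  unfold ddPhiQ
  fun_prop

lemma ddPhiQ_ge {q : ℝ} (hq : 2 < q) (s : ℝ) : q * PsiQ q s ≤ ddPhiQ q s := by
  unfold ddPhiQ
  have : 0 ≤ q * s * (2 * s * (q / 2 - 1) * (1 + s ^ 2) ^ (q / 2 - 1 - 1)) := by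
    have h1 : 0 ≤ q / 2 - 1 := by linarith
    have h2 : q * s * (2 * s * (q / 2 - 1) * (1 + s ^ 2) ^ (q / 2 - 1 - 1))
      = (2 * q) * s ^ 2 * ((q / 2 - 1) * (1 + s ^ 2) ^ (q / 2 - 1 - 1)) := by ring
    rw [h2]; positivity
  linarith

lemma s_dPhiQ {q : ℝ} (hq : 2 < q) (s : ℝ) : 0 ≤ s * dPhiQ q s ∧ s * dPhiQ q s ≤ q * PhiQ q s := by
  have h := PsiQ_pos q s
  have e : s * dPhiQ q s = q * (PsiQ q s * s ^ 2) := by unfold dPhiQ; ring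
  rw [e, PhiQ_eq]
  constructor
  · positivity
  · gcongr; linarith

lemma PhiQ_le {q : ℝ} (hq : 2 < q) (s : ℝ) : PhiQ q s ≤ 2 ^ (q / 2) * (1 + |s| ^ q) := by
  unfold PhiQ
  have h2 : (0:ℝ) < 2 ^ (q / 2) := by positivity
  have hs : 0 ≤ |s| ^ q := by positivity
  rcases le_total (s ^ 2) 1 with h | h
  · calc (1 + s ^ 2) ^ (q / 2) ≤ 2 ^ (q / 2) :=
        Real.rpow_le_rpow (by positivity) (by linarith) (by linarith)
      _ ≤ _ := by nlinarith
  · calc (1 + s ^ 2) ^ (q / 2) ≤ (2 * s ^ 2) ^ (q / 2) :=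
        Real.rpow_le_rpow (by positivity) (by linarith) (by linarith)
      _ = 2 ^ (q / 2) * |s| ^ q := by
        rw [Real.mul_rpow (by norm_num) (by positivity), ← sq_abs s, ← Real.rpow_natCast,
          ← Real.rpow_mul (abs_nonneg s)]
        congr 2; push_cast; ring
      _ ≤ _ := by nlinarith

/-- Energy estimate in `L^q`. -/
lemma energy_q {μp μm T q m1 κm ρbar : ℝ} {c ρ σ u v κ : ℝ → ℝ → ℝ} (hT : 0 < T) (hq : 2 < q)
    (hm1 : 0 < m1) (hκm : 0 ≤ κm)
    (hc : ContDiff ℝ (⊤ : ℕ∞) (uncurry c)) (hσ : ContDiff ℝ (⊤ : ℕ∞) (uncurry σ))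
    (hu : ContDiff ℝ (⊤ : ℕ∞) (uncurry u)) (hv : ContDiff ℝ (⊤ : ℕ∞) (uncurry v))
    (pc : ∀ t x : ℝ, c t (x + 1) = c t x) (pu : ∀ t x : ℝ, u t (x + 1) = u t x)
    (pσ : ∀ t x : ℝ, σ t (x + 1) = σ t x) (pv : ∀ t x : ℝ, v t (x + 1) = v t x)
    (hμ : ∀ t ∈ Icc (0:ℝ) T, ∀ x, m1 ≤ affc μp μm (c t x))
    (hρ : ∀ t ∈ Icc (0:ℝ) T, ∀ x, 0 < ρ t x ∧ ρ t x ≤ ρbar)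
    (hκ : ∀ t ∈ Icc (0:ℝ) T, ∀ x, 0 ≤ κ t x ∧ κ t x ≤ κm)
    (htr : ∀ t ∈ Icc (0:ℝ) T, ∀ x, pdt c t x + u t x * pdx c t x = 0)
    (hmo : ∀ t ∈ Icc (0:ℝ) T, ∀ x, ρ t x * v t x = pdx σ t x)
    (hst : ∀ t ∈ Icc (0:ℝ) T, ∀ x, pdt σ t x + u t x * pdx σ t x
      = affc μp μm (c t x) * pdx v t x - κ t x * (σ t x * pdx u t x)) :
    (∀ t ∈ Icc (0:ℝ) T, ∫ x in (0:ℝ)..1, PhiQ q (σ t x) / affc μp μm (c t x) ≤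
      (∫ x in (0:ℝ)..1, PhiQ q (σ 0 x) / affc μp μm (c 0 x)) *
        Real.exp ((1 + κm * q) * ∫ s in (0:ℝ)..T, supn (pdx u) s)) ∧
    (q / ρbar) * (∫ t in (0:ℝ)..T, ∫ x in (0:ℝ)..1, PsiQ q (σ t x) * pdx σ t x ^ 2) ≤
      (∫ x in (0:ℝ)..1, PhiQ q (σ 0 x) / affc μp μm (c 0 x)) *
        Real.exp ((1 + κm * q) * ∫ s in (0:ℝ)..T, supn (pdx u) s) := by
  have cc := hc.continuous
  have cσ := hσ.continuous
  have cu := hu.continuous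
  have cv := hv.continuous
  have cct := (smooth_pdt hc).continuous
  have ccx := (smooth_pdx hc).continuous
  have cσt := (smooth_pdt hσ).continuous
  have cσx := (smooth_pdx hσ).continuous
  have cux := (smooth_pdx hu).continuous
  have cvx := (smooth_pdx hv).continuous
  have h0T : (0:ℝ) ∈ Icc (0:ℝ) T := ⟨le_rfl, hT.le⟩
  have hρb : 0 < ρbar := (hρ 0 h0T 0).1.trans_le (hρ 0 h0T 0).2
  set g : ℝ → ℝ → ℝ := fun t x => (max (affc μp μm (c t x)) m1)⁻¹ with hg
  have cg : Continuous (uncurry g) := by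
    apply Continuous.inv₀
    · have : Continuous fun p : ℝ × ℝ => c p.1 p.2 := cc
      unfold affc
      fun_prop
    · intro p; exact (lt_of_lt_of_le hm1 (le_max_right _ _)).ne'
  have hgI : ∀ t ∈ Icc (0:ℝ) T, ∀ x, g t x = (affc μp μm (c t x))⁻¹ := fun t ht x => by
    simp only [hg]; rw [max_eq_left (hμ t ht x)]
  have hμ0 : ∀ t ∈ Icc (0:ℝ) T, ∀ x, affc μp μm (c t x) ≠ 0 :=
    fun t ht x => (hm1.trans_le (hμ t ht x)).ne'
  have aft : ∀ t x, HasDerivAt (fun s => affc μp μm (c s x)) (pdt c t x * (μp - μm)) t := by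
    intro t x
    unfold affc
    refine (((hdt hc t x).mul_const μp).add
      (((hdt hc t x).const_sub 1).mul_const μm)).congr_deriv ?_
    ring
  have afx : ∀ t x, HasDerivAt (fun s => affc μp μm (c t s)) (pdx c t x * (μp - μm)) x := by
    intro t x
    unfold affc
    refine (((hdx hc t x).mul_const μp).add
      (((hdx hc t x).const_sub 1).mul_const μm)).congr_deriv ?_
    ring
  set G : ℝ → ℝ → ℝ := fun t x => dPhiQ q (σ t x) * pdt σ t x * g t x
    - PhiQ q (σ t x) * (pdt c t x * (μp - μm)) * g t x ^ 2 with hGdef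
  have cG : Continuous (uncurry G) := by
    have e : uncurry G = fun p => dPhiQ q (uncurry σ p) * uncurry (pdt σ) p * uncurry g p
      - PhiQ q (uncurry σ p) * (uncurry (pdt c) p * (μp - μm)) * uncurry g p ^ 2 := by
      ext ⟨t, x⟩; rfl
    rw [e]; fun_prop
  have cD : Continuous (uncurry fun t x => PsiQ q (σ t x) * pdx σ t x ^ 2) := by
    have e : (uncurry fun t x => PsiQ q (σ t x) * pdx σ t x ^ 2)
      = fun p => PsiQ q (uncurry σ p) * uncurry (pdx σ) p ^ 2 := by
      ext ⟨t, x⟩; rfl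
    rw [e]; fun_prop
  have hFc : ∀ t ∈ Icc (0:ℝ) T, Continuous fun x => PhiQ q (σ t x) / affc μp μm (c t x) := by
    intro t ht
    have h1 := cont_slice cσ t
    have h2 := cont_slice cc t
    apply Continuous.div (by fun_prop) _ (hμ0 t ht)
    unfold affc; fun_prop
  have hFd : ∀ t ∈ Icc (0:ℝ) T, ∀ x,
      HasDerivAt (fun s => PhiQ q (σ s x) / affc μp μm (c s x)) (G t x) t := by
    intro t ht x
    refine ((((PhiQ_deriv q (σ t x)).comp t (hdt hσ t x))).div (aft t x) (hμ0 t ht x)).congr_deriv ?_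
    have := hμ0 t ht x
    simp only [hGdef, hgI t ht x, comp_apply]
    field_simp
  have hmain := int_diff cG hFc hFd
  have hint : ∀ t ∈ Icc (0:ℝ) T, ∫ x in (0:ℝ)..1, G t x ≤
      (1 + κm * q) * supn (pdx u) t * (∫ x in (0:ℝ)..1, PhiQ q (σ t x) / affc μp μm (c t x))
        - (q / ρbar) * ∫ x in (0:ℝ)..1, PsiQ q (σ t x) * pdx σ t x ^ 2 := by
    intro t ht
    set P' : ℝ → ℝ := fun x => -(pdx u t x * (PhiQ q (σ t x) * g t x)
      + u t x * (dPhiQ q (σ t x) * pdx σ t x * g t x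
        - PhiQ q (σ t x) * (pdx c t x * (μp - μm)) * g t x ^ 2))
      + (ddPhiQ q (σ t x) * pdx σ t x * v t x + dPhiQ q (σ t x) * pdx v t x) with hP'
    have s1 := cont_slice cσ t
    have s2 := cont_slice cc t
    have s3 := cont_slice cu t
    have s4 := cont_slice cv t
    have s5 := cont_slice cσx t
    have s6 := cont_slice ccx t
    have s7 := cont_slice cux t
    have s8 := cont_slice cvx t
    have s9 := cont_slice cg t
    have s10 := cont_slice cG t
    have cP' : Continuous P' := by fun_prop
    have hP : ∀ x, HasDerivAt (fun x => -(u t x * (PhiQ q (σ t x) / affc μp μm (c t x)))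
        + dPhiQ q (σ t x) * v t x) (P' x) x := by
      intro x
      refine (((hdx hu t x).mul ((((PhiQ_deriv q (σ t x)).comp x (hdx hσ t x))).div
        (afx t x) (hμ0 t ht x))).neg.add
        (((dPhiQ_deriv q (σ t x)).comp x (hdx hσ t x)).mul (hdx hv t x))).congr_deriv ?_
      have := hμ0 t ht x
      simp only [hP', hgI t ht x, comp_apply, Pi.div_apply]
      field_simp
    have hz := int_deriv_per hP cP' (by
      have e1 := pu t 0
      have e2 := pσ t 0
      have e3 := pc t 0
      have e4 := pv t 0
      rw [zero_add] at e1 e2 e3 e4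
      simp only [e1, e2, e3, e4])
    have e1 : ∫ x in (0:ℝ)..1, G t x = ∫ x in (0:ℝ)..1, (G t x - P' x) := by
      rw [integral_sub (s10.intervalIntegrable _ _) (cP'.intervalIntegrable _ _), hz, sub_zero]
    have iF := (hFc t ht).intervalIntegrable (μ := volume) 0 1
    have iD := (cont_slice cD t).intervalIntegrable (μ := volume) 0 1
    rw [e1, ← intervalIntegral.integral_const_mul, ← intervalIntegral.integral_const_mul,
      ← integral_sub (iF.const_mul _) (iD.const_mul _)]
    apply integral_mono_on zero_le_one
    · exact (s10.sub cP').intervalIntegrable _ _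
    · exact (iF.const_mul _).sub (iD.const_mul _)
    · intro x hx
      have hμx := hμ0 t ht x
      have hμpos : 0 < affc μp μm (c t x) := hm1.trans_le (hμ t ht x)
      have k1 : G t x - P' x = pdx u t x * (PhiQ q (σ t x) / affc μp μm (c t x))
          - κ t x * (σ t x * dPhiQ q (σ t x)) * pdx u t x / affc μp μm (c t x)
          - ddPhiQ q (σ t x) * (pdx σ t x * v t x) := by
        simp only [hGdef, hP', hgI t ht x]
        have a1 := hst t ht x
        have a2 := htr t ht x
        field_simp
        linear_combination dPhiQ q (σ t x) * affc μp μm (c t x) * a1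
          - PhiQ q (σ t x) * (μp - μm) * a2
      rw [k1]
      obtain ⟨r1, r2⟩ := hρ t ht x
      have hux := le_supn cux t hx
      obtain ⟨κ1, κ2⟩ := hκ t ht x
      obtain ⟨d1, d2⟩ := s_dPhiQ hq (σ t x)
      have hΦ := PhiQ_pos q (σ t x)
      have b1 : pdx u t x * (PhiQ q (σ t x) / affc μp μm (c t x))
          ≤ supn (pdx u) t * (PhiQ q (σ t x) / affc μp μm (c t x)) := by
        gcongr
        exact (le_abs_self _).trans hux
      have b2 : - (κ t x * (σ t x * dPhiQ q (σ t x)) * pdx u t x / affc μp μm (c t x))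
          ≤ κm * (q * PhiQ q (σ t x)) * supn (pdx u) t / affc μp μm (c t x) := by
        rw [← neg_div]
        gcongr
        rw [← mul_neg]
        have : 0 ≤ supn (pdx u) t := supn_nonneg t
        calc κ t x * (σ t x * dPhiQ q (σ t x)) * -pdx u t x
            ≤ κ t x * (σ t x * dPhiQ q (σ t x)) * supn (pdx u) t := by
              gcongr
              exact (neg_le_abs _).trans hux
          _ ≤ _ := by gcongr
      have b3 : q / ρbar * (PsiQ q (σ t x) * pdx σ t x ^ 2)
          ≤ ddPhiQ q (σ t x) * (pdx σ t x * v t x) := by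
        have f1 : pdx σ t x * v t x = pdx σ t x ^ 2 / ρ t x := by
          rw [← hmo t ht x]; field_simp
        rw [f1]
        have f2 : pdx σ t x ^ 2 / ρbar ≤ pdx σ t x ^ 2 / ρ t x := by gcongr
        calc q / ρbar * (PsiQ q (σ t x) * pdx σ t x ^ 2)
            = (q * PsiQ q (σ t x)) * (pdx σ t x ^ 2 / ρbar) := by ring
          _ ≤ (q * PsiQ q (σ t x)) * (pdx σ t x ^ 2 / ρ t x) := by
              have := PsiQ_pos q (σ t x)
              gcongr
          _ ≤ _ := by
              have := ddPhiQ_ge hq (σ t x)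
              gcongr
      have b4 : (1 + κm * q) * supn (pdx u) t * (PhiQ q (σ t x) / affc μp μm (c t x))
        = supn (pdx u) t * (PhiQ q (σ t x) / affc μp μm (c t x))
        + κm * (q * PhiQ q (σ t x)) * supn (pdx u) t / affc μp μm (c t x) := by ring
      rw [b4]
      linarith
  refine gronwall_diss hT.le (cont_int cG) (supn_cont cux) (cont_int cD)
    (by positivity) (by positivity) (fun t => supn_nonneg t) ?_ hmain ?_ hint
  · intro t
    apply intervalIntegral.integral_nonneg zero_le_one
    intro x _
    have := PsiQ_pos q (σ t x)
    positivity
  · intro t ht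
    apply intervalIntegral.integral_nonneg zero_le_one
    intro x _
    have := PhiQ_pos q (σ t x)
    have : 0 < affc μp μm (c t x) := hm1.trans_le (hμ t ht x)
    positivity

/-- Sup bound through the `L^q` energy. -/
lemma sup_q {q Y : ℝ} {σ : ℝ → ℝ → ℝ} (hq : 2 < q) (hσ : ContDiff ℝ (⊤ : ℕ∞) (uncurry σ)) (t : ℝ)
    (hY : ∫ x in (0:ℝ)..1, PhiQ q (σ t x) ≤ Y) :
    supn (fun s y => 1 + σ s y ^ 2) t ^ q ≤ (Y + q / 2 * (Y + 1)) ^ 2 *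
      (1 + ∫ x in (0:ℝ)..1, PsiQ q (σ t x) * pdx σ t x ^ 2) := by
  set D := ∫ x in (0:ℝ)..1, PsiQ q (σ t x) * pdx σ t x ^ 2 with hD
  have s1 := cont_slice hσ.continuous t
  have s2 := cont_slice (smooth_pdx hσ).continuous t
  have cPhi : Continuous fun x => PhiQ q (σ t x) := by fun_prop
  have cPsi : Continuous fun x => PsiQ q (σ t x) * pdx σ t x ^ 2 := by fun_prop
  have cd : Continuous fun x => dPhiQ q (σ t x) * pdx σ t x := by fun_prop
  have hD0 : 0 ≤ D := by
    apply intervalIntegral.integral_nonneg zero_le_one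
    intro x _
    have := PsiQ_pos q (σ t x)
    positivity
  have hY0 : 0 ≤ Y := le_trans (intervalIntegral.integral_nonneg zero_le_one
    fun x _ => (PhiQ_pos q (σ t x)).le) hY
  set L := √(1 + D) with hL
  have hL1 : 1 ≤ L := Real.one_le_sqrt.2 (by linarith)
  have hL2 : L ^ 2 = 1 + D := Real.sq_sqrt (by linarith)
  have hL0 : 0 < L := by linarith
  have hpt : ∀ x ∈ Icc (0:ℝ) 1, PhiQ q (σ t x) ≤ (Y + q / 2 * (Y + 1)) * L := by
    intro x hx
    have h1 := sup_le_mean (f := fun x => PhiQ q (σ t x))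
      (fun x => (PhiQ_deriv q (σ t x)).comp x (hdx hσ t x)) cd hx
    have h2 : ∫ z in (0:ℝ)..1, |dPhiQ q (σ t z) * pdx σ t z| ≤
        ∫ z in (0:ℝ)..1, ((q / 2 * L) * PhiQ q (σ t z)
          + (q / 2 / L) * (PsiQ q (σ t z) * pdx σ t z ^ 2)) := by
      apply integral_mono_on zero_le_one
      · exact cd.abs.intervalIntegrable _ _
      · exact ((cPhi.intervalIntegrable _ _).const_mul _).add
          ((cPsi.intervalIntegrable _ _).const_mul _)
      · intro z _
        have hp := PsiQ_pos q (σ t z)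
        have e : |dPhiQ q (σ t z) * pdx σ t z| = q * PsiQ q (σ t z) * (|σ t z| * |pdx σ t z|) := by
          unfold dPhiQ
          rw [abs_mul, abs_mul, abs_mul, abs_of_pos hp, abs_of_pos (by linarith : 0 < q)]; ring
        have y : |σ t z| * |pdx σ t z| ≤ (L * (1 + σ t z ^ 2) + pdx σ t z ^ 2 / L) / 2 := by
          have : (L * (1 + σ t z ^ 2) + pdx σ t z ^ 2 / L) / 2 - |σ t z| * |pdx σ t z|
            = ((L * |σ t z| - |pdx σ t z|) ^ 2 / L + L) / 2 := by
            rw [← sq_abs (σ t z), ← sq_abs (pdx σ t z)]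
            field_simp; ring
          have h3 : 0 ≤ ((L * |σ t z| - |pdx σ t z|) ^ 2 / L + L) / 2 := by positivity
          linarith
        rw [e]
        calc q * PsiQ q (σ t z) * (|σ t z| * |pdx σ t z|)
            ≤ q * PsiQ q (σ t z) * ((L * (1 + σ t z ^ 2) + pdx σ t z ^ 2 / L) / 2) := by gcongr
          _ = _ := by rw [PhiQ_eq]; ring
    rw [integral_add ((cPhi.intervalIntegrable _ _).const_mul _)
          ((cPsi.intervalIntegrable _ _).const_mul _), intervalIntegral.integral_const_mul,
          intervalIntegral.integral_const_mul, ← hD] at h2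
    have h3 : q / 2 * L * (∫ z in (0:ℝ)..1, PhiQ q (σ t z)) ≤ q / 2 * L * Y := by gcongr
    have h4 : q / 2 / L * D ≤ q / 2 * L := by
      rw [div_mul_eq_mul_div, div_le_iff₀ hL0]
      nlinarith
    have h5 : Y ≤ Y * L := le_mul_of_one_le_right hY0 hL1
    nlinarith
  have hKL : 0 ≤ (Y + q / 2 * (Y + 1)) * L := by positivity
  have hsup : supn (fun s y => 1 + σ s y ^ 2) t ≤ ((Y + q / 2 * (Y + 1)) * L) ^ (q / 2)⁻¹ := by
    apply supn_le
    intro x hx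
    have hpos : 0 < 1 + σ t x ^ 2 := by positivity
    rw [abs_of_pos hpos]
    rw [Real.le_rpow_inv_iff_of_pos hpos.le hKL (by linarith)]
    exact hpt x hx
  have h1 : supn (fun s y => 1 + σ s y ^ 2) t ^ (q / 2) ≤ (Y + q / 2 * (Y + 1)) * L := by
    rwa [Real.le_rpow_inv_iff_of_pos (supn_nonneg t) hKL (by linarith)] at hsup
  have h2 : supn (fun s y => 1 + σ s y ^ 2) t ^ q
      = (supn (fun s y => 1 + σ s y ^ 2) t ^ (q / 2)) ^ 2 := by
    rw [← Real.rpow_natCast, ← Real.rpow_mul (supn_nonneg t)]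
    congr 1; push_cast; ring
  rw [h2, ← hL2, ← mul_pow]
  exact pow_le_pow_left₀ (Real.rpow_nonneg (supn_nonneg t) _) h1 2

/-- Sup bound for the derivative of the stress. -/
lemma sup_dx {μ : ℝ → ℝ} {M1 R1 R2 K5 Km : ℝ} {ρ σ u v κ : ℝ → ℝ → ℝ} (t : ℝ)
    (hσ : ContDiff ℝ (⊤ : ℕ∞) (uncurry σ))
    (hu : ContDiff ℝ (⊤ : ℕ∞) (uncurry u)) (hv : ContDiff ℝ (⊤ : ℕ∞) (uncurry v))
    (pσ : ∀ x : ℝ, σ t (x + 1) = σ t x) (hM1 : 0 < M1) (hR1 : 0 < R1) (hKm : 0 ≤ Km)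
    (hμ : ∀ x, M1 ≤ μ x)
    (hρ : ∀ x, R1 ≤ ρ t x ∧ ρ t x ≤ R2)
    (hκ : ∀ x, 0 ≤ κ t x ∧ κ t x ≤ Km)
    (hmo : ∀ x, ρ t x * v t x = pdx σ t x)
    (hst : ∀ x, pdt σ t x + u t x * pdx σ t x
      = μ x * pdx v t x - κ t x * (σ t x * pdx u t x))
    (h5 : ∫ x in (0:ℝ)..1, σ t x ^ 2 ≤ K5) (l : ℝ) (hl : 0 < l) :
    supn (pdx σ) t ^ 2 ≤ (R2 ^ 2 * (1 / R1 ^ 2 + 2 / M1 ^ 2)) *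
      (l * (∫ x in (0:ℝ)..1, pdx σ t x ^ 2) +
      ((∫ x in (0:ℝ)..1, (pdt σ t x + u t x * pdx σ t x) ^ 2)
        + (Km ^ 2 * K5) * supn (pdx u) t ^ 2) / l) := by
  have s1 := cont_slice hσ.continuous t
  have s2 := cont_slice (smooth_pdx hσ).continuous t
  have s3 := cont_slice (smooth_pdt hσ).continuous t
  have s4 := cont_slice hu.continuous t
  have s5 := cont_slice (smooth_pdx hu).continuous t
  have s6 := cont_slice hv.continuous t
  have s7 := cont_slice (smooth_pdx hv).continuous t
  have hR2 : 0 < R2 := hR1.trans_le ((hρ 0).1.trans (hρ 0).2)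
  set A := ∫ x in (0:ℝ)..1, pdx σ t x ^ 2 with hA
  set B := ∫ x in (0:ℝ)..1, (pdt σ t x + u t x * pdx σ t x) ^ 2 with hB
  set a := supn (pdx u) t with ha
  have hA0 : 0 ≤ A := intervalIntegral.integral_nonneg zero_le_one fun x _ => sq_nonneg _
  have hB0 : 0 ≤ B := intervalIntegral.integral_nonneg zero_le_one fun x _ => sq_nonneg _
  have hK5 : 0 ≤ K5 := le_trans (intervalIntegral.integral_nonneg zero_le_one
    fun x _ => sq_nonneg _) h5
  have ha0 : 0 ≤ a := supn_nonneg t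
  obtain ⟨y, hy, hy0⟩ : ∃ y ∈ Ioo (0:ℝ) 1, deriv (fun y => σ t y) y = 0 := by
    apply exists_deriv_eq_zero zero_lt_one s1.continuousOn
    have := pσ 0
    rw [zero_add] at this
    exact this.symm
  have hvy : v t y = 0 := by
    have h1 := hmo y
    have h2 : pdx σ t y = 0 := hy0
    rw [h2] at h1
    exact (mul_eq_zero.1 h1).resolve_left (hR1.trans_le (hρ y).1).ne'
  have iv : ∫ x in (0:ℝ)..1, v t x ^ 2 ≤ (1 / R1 ^ 2) * A := by
    rw [hA, ← intervalIntegral.integral_const_mul]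
    apply integral_mono_on zero_le_one
    · exact (by fun_prop : Continuous fun x => v t x ^ 2).intervalIntegrable _ _
    · exact (by fun_prop : Continuous fun x => 1 / R1 ^ 2 * pdx σ t x ^ 2).intervalIntegrable _ _
    · intro x _
      rw [← hmo x, mul_pow, ← mul_assoc]
      apply le_mul_of_one_le_left (sq_nonneg _)
      rw [one_div, inv_mul_eq_div, one_le_div (by positivity)]
      exact pow_le_pow_left₀ hR1.le (hρ x).1 2
  have ivx : ∫ x in (0:ℝ)..1, pdx v t x ^ 2 ≤ (2 / M1 ^ 2) * (B + (Km ^ 2 * K5) * a ^ 2) := by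
    have h1 : ∫ x in (0:ℝ)..1, pdx v t x ^ 2 ≤ ∫ x in (0:ℝ)..1,
        ((2 / M1 ^ 2) * (pdt σ t x + u t x * pdx σ t x) ^ 2
          + (2 / M1 ^ 2 * (Km ^ 2 * a ^ 2)) * σ t x ^ 2) := by
      apply integral_mono_on zero_le_one
      · exact (by fun_prop : Continuous fun x => pdx v t x ^ 2).intervalIntegrable _ _
      · exact (by fun_prop : Continuous fun x => 
          ((2 / M1 ^ 2) * (pdt σ t x + u t x * pdx σ t x) ^ 2
          + (2 / M1 ^ 2 * (Km ^ 2 * a ^ 2)) * σ t x ^ 2)).intervalIntegrable _ _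
      · intro x hx
        have e1 := hst x
        have hux : |pdx u t x| ≤ a := le_supn (smooth_pdx hu).continuous t hx
        set d := pdt σ t x + u t x * pdx σ t x with hd
        have e2 : μ x * pdx v t x = d + κ t x * (σ t x * pdx u t x) := by linarith
        have e3 : (M1 * pdx v t x) ^ 2 ≤ (μ x * pdx v t x) ^ 2 := by
          rw [mul_pow, mul_pow]
          have := hμ x
          gcongr
        have e4 : (κ t x * (σ t x * pdx u t x)) ^ 2 ≤ Km ^ 2 * a ^ 2 * σ t x ^ 2 := by
          have h1 : κ t x ^ 2 ≤ Km ^ 2 := pow_le_pow_left₀ (hκ x).1 (hκ x).2 2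
          have h2 : pdx u t x ^ 2 ≤ a ^ 2 := by
            rw [← sq_abs]; exact pow_le_pow_left₀ (abs_nonneg _) hux 2
          calc (κ t x * (σ t x * pdx u t x)) ^ 2 = κ t x ^ 2 * pdx u t x ^ 2 * σ t x ^ 2 := by ring
            _ ≤ _ := by gcongr
        have e5 : (M1 * pdx v t x) ^ 2 ≤ 2 * d ^ 2 + 2 * (Km ^ 2 * a ^ 2 * σ t x ^ 2) := by
          rw [e2] at e3
          nlinarith [sq_nonneg (d - κ t x * (σ t x * pdx u t x))]
        have e6 : pdx v t x ^ 2 = (M1 * pdx v t x) ^ 2 / M1 ^ 2 := by field_simp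
        rw [e6]
        calc (M1 * pdx v t x) ^ 2 / M1 ^ 2
            ≤ (2 * d ^ 2 + 2 * (Km ^ 2 * a ^ 2 * σ t x ^ 2)) / M1 ^ 2 := by gcongr
          _ = _ := by ring
    rw [integral_add ((by fun_prop : Continuous fun x =>
          ((2 / M1 ^ 2) * (pdt σ t x + u t x * pdx σ t x) ^ 2)).intervalIntegrable _ _)
        ((by fun_prop : Continuous fun x =>
          (2 / M1 ^ 2 * (Km ^ 2 * a ^ 2)) * σ t x ^ 2).intervalIntegrable _ _),
      intervalIntegral.integral_const_mul, intervalIntegral.integral_const_mul, ← hB] at h1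
    have h2 : 2 / M1 ^ 2 * (Km ^ 2 * a ^ 2) * (∫ x in (0:ℝ)..1, σ t x ^ 2)
      ≤ 2 / M1 ^ 2 * (Km ^ 2 * a ^ 2) * K5 := by gcongr
    calc _ ≤ _ := h1
      _ ≤ _ := add_le_add_right h2 _
      _ = _ := by ring
  set Q := B + (Km ^ 2 * K5) * a ^ 2 with hQ
  have hQ0 : 0 ≤ Q := by positivity
  have hpt : ∀ x ∈ Icc (0:ℝ) 1, |pdx σ t x| ≤
      √((R2 ^ 2 * (1 / R1 ^ 2 + 2 / M1 ^ 2)) * (l * A + Q / l)) := by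
    intro x hx
    apply Real.abs_le_sqrt
    have h1 := interp_bound (hdx hv t) s7 hx ⟨hy.1.le, hy.2.le⟩ hvy hl
    have h2 : v t x ^ 2 ≤ l * ((1 / R1 ^ 2) * A) + (2 / M1 ^ 2 * Q) / l := by
      refine h1.trans ?_
      gcongr
    have h3 : pdx σ t x ^ 2 ≤ R2 ^ 2 * v t x ^ 2 := by
      rw [← hmo x, mul_pow]
      have := hρ x
      have : 0 ≤ ρ t x := by linarith
      gcongr
      exact (hρ x).2
    have p1 : 0 ≤ l * A * (2 / M1 ^ 2) := by positivity
    have p2 : 0 ≤ Q / l * (1 / R1 ^ 2) := by positivity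
    calc pdx σ t x ^ 2 ≤ R2 ^ 2 * v t x ^ 2 := h3
      _ ≤ R2 ^ 2 * (l * ((1 / R1 ^ 2) * A) + (2 / M1 ^ 2 * Q) / l) := by gcongr
      _ ≤ R2 ^ 2 * (l * ((1 / R1 ^ 2) * A) + (2 / M1 ^ 2 * Q) / l
          + (l * A * (2 / M1 ^ 2) + Q / l * (1 / R1 ^ 2))) := by
            apply mul_le_mul_of_nonneg_left _ (sq_nonneg _)
            linarith
      _ = _ := by ring
  have hs := supn_le (f := pdx σ) hpt
  have := pow_le_pow_left₀ (supn_nonneg t) hs 2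
  rwa [Real.sq_sqrt (by positivity)] at this

set_option maxHeartbeats 4000000 in
/-- Higher integrability of the stress under `W^{1,2+η}` initial
data: there is `C > 0`, depending only on the physical constants, `ρ̲, ρ̄, T, η`,
the a priori constants `C₅, C₉, C₁₁` and `∫₀¹|σ(0)|^{2+η}`, such that
`∫₀ᵀ‖∂ₓσ(t)‖_{L^∞(0,1)} ≤ C` and `∫₀ᵀ‖∂ₓ(σ(t)²)‖_{L^∞(0,1)} ≤ C`. -/
theorem stmt18 (μp μm γp γm kp km ρlo ρbar T η C5 C9 C11 S : ℝ)
    (hconst : GoodConsts μp μm γp γm kp km) (hT : 0 < T)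
    (hρlo : 0 < ρlo) (hρ : ρlo ≤ ρbar) (hη : 0 < η)
    (hC5 : 0 < C5) (hC9 : 0 < C9) (hC11 : 0 < C11) :
    ∃ C > (0:ℝ), ∀ c ρ θ u : ℝ → ℝ → ℝ,
      ContDiff ℝ (⊤ : ℕ∞) (uncurry c) → ContDiff ℝ (⊤ : ℕ∞) (uncurry ρ) →
      ContDiff ℝ (⊤ : ℕ∞) (uncurry θ) → ContDiff ℝ (⊤ : ℕ∞) (uncurry u) →
      (∀ t ∈ Icc (0:ℝ) T, ∀ x : ℝ,
        c t x ∈ Icc (0:ℝ) 1 ∧ ρlo ≤ ρ t x ∧ ρ t x ≤ ρbar ∧ 0 < θ t x) →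
      MesoEqns μp μm γp γm kp km T c ρ θ u →
      (∀ t ∈ Icc (0:ℝ) T,
        (∫ x in (0:ℝ)..1, (sigm μp μm γp γm c ρ θ u t x) ^ 2)
          + (∫ s in (0:ℝ)..T, ∫ x in (0:ℝ)..1,
              (pdx (sigm μp μm γp γm c ρ θ u) s x) ^ 2) ≤ C5) →
      (∫ t in (0:ℝ)..T, (⨆ x : Icc (0:ℝ) 1, |pdx u t x.1|) ^ 2) ≤ C9 →
      (∀ t ∈ Icc (0:ℝ) T,
        min 1 t * (∫ x in (0:ℝ)..1, (pdx (sigm μp μm γp γm c ρ θ u) t x) ^ 2)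
          + (∫ s in (0:ℝ)..t, min 1 s * ∫ x in (0:ℝ)..1,
              (pdt (sigm μp μm γp γm c ρ θ u) s x
                + u s x * pdx (sigm μp μm γp γm c ρ θ u) s x) ^ 2) ≤ C11) →
      (∫ x in (0:ℝ)..1, |sigm μp μm γp γm c ρ θ u 0 x| ^ (2 + η)) = S →
      (∫ t in (0:ℝ)..T,
          ⨆ x : Icc (0:ℝ) 1, |pdx (sigm μp μm γp γm c ρ θ u) t x.1|) ≤ C
      ∧ (∫ t in (0:ℝ)..T,
          ⨆ x : Icc (0:ℝ) 1,
            |pdx (fun s y => (sigm μp μm γp γm c ρ θ u s y) ^ 2) t x.1|) ≤ C := by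
  obtain ⟨hμp, hμm, hγp, hγm, hkp, hkm⟩ := hconst
  set q : ℝ := 2 + η with hqdef
  have hq : 2 < q := by linarith
  set m1 := min μp μm with hm1d
  set m2 := max μp μm with hm2d
  have hm1 : 0 < m1 := lt_min hμp hμm
  have hm2 : 0 < m2 := hμp.trans_le (le_max_left _ _)
  set k1 := min kp km with hk1d
  have hk1 : 0 < k1 := lt_min hkp hkm
  set κm := 1 + max γp γm / k1 with hκmd
  have hγ0 : 0 < max γp γm := lt_trans (by linarith) (lt_of_lt_of_le hγp (le_max_left _ _))
  have hκm : 0 ≤ κm := by positivity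
  have hρb : 0 < ρbar := hρlo.trans_le hρ
  set Z := (1 / m1 * (2 ^ (q / 2) * (1 + S))) * Real.exp ((1 + κm * q) * (T + C9)) with hZ
  set Y := m2 * Z with hYd
  set CD := Z / (q / ρbar) with hCD
  set K1 := ρbar ^ 2 * (1 / ρlo ^ 2 + 2 / m1 ^ 2) with hK1
  set K2 := (Y + q / 2 * (Y + 1)) ^ 2 with hK2
  set K3 := κm ^ 2 * C5 with hK3
  set C0 := K1 * (C5 + (1 + T) * C11 + T * K3 * C9) + K2 * (T + CD)
      + T ^ (-(q / (2 * (q - 1))) + 1) / (-(q / (2 * (q - 1))) + 1) with hC0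
  refine ⟨max 1 (2 * C0), lt_max_of_lt_left one_pos, ?_⟩
  intro c ρ θ u hc hr hθ hu hbd hE h5 h9 h11 hS
  have hσ := smooth_sigm μp μm γp γm hc hr hθ hu
  have hMom := momentum_eq hr hu hE
  have hStr := stress_eq hc hr hθ hu hE
  obtain ⟨pc, pr, pθ, pu, htr, -, -, -⟩ := hE
  have pux := pdx_per pu
  have put := pdt_per pu
  have pσ : ∀ t x : ℝ, sigm μp μm γp γm c ρ θ u t (x + 1) = sigm μp μm γp γm c ρ θ u t x := by
    intro t x; unfold sigm; rw [pc, pr, pθ, pux]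
  set σ := sigm μp μm γp γm c ρ θ u with hσd
  set v : ℝ → ℝ → ℝ := fun s y => pdt u s y + u s y * pdx u s y with hvd
  have hv : ContDiff ℝ (⊤ : ℕ∞) (uncurry v) := by
    have e : uncurry v = fun p => uncurry (pdt u) p + uncurry u p * uncurry (pdx u) p := by
      ext ⟨t, x⟩; rfl
    have h1 := smooth_pdt hu
    have h2 := smooth_pdx hu
    rw [e]; fun_prop
  have pv : ∀ t x : ℝ, v t (x + 1) = v t x := by
    intro t x; simp only [hvd]; rw [put, pu, pux]
  have haff : ∀ a b : ℝ, ∀ t ∈ Icc (0:ℝ) T, ∀ x, min a b ≤ affc a b (c t x) ∧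
      affc a b (c t x) ≤ max a b := by
    intro a b t ht x
    obtain ⟨⟨c0, c1⟩, -⟩ := hbd t ht x
    unfold affc
    constructor
    · have e1 := mul_le_mul_of_nonneg_left (min_le_left a b) c0
      have e2 := mul_le_mul_of_nonneg_left (min_le_right a b) (sub_nonneg.2 c1)
      linarith
    · have e1 := mul_le_mul_of_nonneg_left (le_max_left a b) c0
      have e2 := mul_le_mul_of_nonneg_left (le_max_right a b) (sub_nonneg.2 c1)
      linarith
  set κ : ℝ → ℝ → ℝ := fun t x => 1 + (affc γp γm (c t x) - 1) / affc kp km (c t x) with hκd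
  have hk0 : ∀ t ∈ Icc (0:ℝ) T, ∀ x, 0 < affc kp km (c t x) :=
    fun t ht x => hk1.trans_le (haff kp km t ht x).1
  have hκ : ∀ t ∈ Icc (0:ℝ) T, ∀ x, 0 ≤ κ t x ∧ κ t x ≤ κm := by
    intro t ht x
    have a1 := haff kp km t ht x
    have a2 := haff γp γm t ht x
    have a3 := hk0 t ht x
    have a4 : 1 < min γp γm := lt_min hγp hγm
    have a5 : 0 ≤ affc γp γm (c t x) - 1 := by linarith
    constructor
    · simp only [hκd]; positivity
    · simp only [hκd, hκmd]
      gcongr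
      · linarith
      · exact a1.1
  have hst : ∀ t ∈ Icc (0:ℝ) T, ∀ x, pdt σ t x + u t x * pdx σ t x
      = affc μp μm (c t x) * pdx v t x - κ t x * (σ t x * pdx u t x) := by
    intro t ht x
    have a3 := hk0 t ht x
    have := hStr t ht x (hρlo.trans_le (hbd t ht x).2.1).ne'
    apply mul_left_cancel₀ a3.ne'
    rw [this]
    simp only [hκd]
    field_simp
    ring
  have hμ1 : ∀ t ∈ Icc (0:ℝ) T, ∀ x, m1 ≤ affc μp μm (c t x) :=
    fun t ht x => (haff μp μm t ht x).1
  have hρ' : ∀ t ∈ Icc (0:ℝ) T, ∀ x, ρlo ≤ ρ t x ∧ ρ t x ≤ ρbar :=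
    fun t ht x => ⟨(hbd t ht x).2.1, (hbd t ht x).2.2.1⟩
  have h0T : (0:ℝ) ∈ Icc (0:ℝ) T := ⟨le_rfl, hT.le⟩
  have hTT : T ∈ Icc (0:ℝ) T := ⟨hT.le, le_rfl⟩
  obtain ⟨en1, en2⟩ := energy_q (κ := κ) (ρ := ρ) (ρbar := ρbar) hT hq hm1 hκm hc hσ hu hv pc pu pσ pv
    hμ1 (fun t ht x => ⟨hρlo.trans_le (hρ' t ht x).1, (hρ' t ht x).2⟩) hκ htr hMom hst
  have cux := (smooth_pdx hu).continuous
  have cσx := (smooth_pdx hσ).continuous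
  have cσt := (smooth_pdt hσ).continuous
  have cσ := hσ.continuous
  have cu := hu.continuous
  have ca : Continuous (supn (pdx u)) := supn_cont cux
  have h9' : ∫ t in (0:ℝ)..T, supn (pdx u) t ^ 2 ≤ C9 := h9
  have hia : ∫ t in (0:ℝ)..T, supn (pdx u) t ≤ T + C9 := by
    have e1 : ∫ t in (0:ℝ)..T, supn (pdx u) t ≤ ∫ t in (0:ℝ)..T, (1 + supn (pdx u) t ^ 2) := by
      apply integral_mono_on hT.le (ca.intervalIntegrable _ _)
      · exact (by fun_prop : Continuous fun t => 1 + supn (pdx u) t ^ 2).intervalIntegrable _ _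
      · intro t _
        nlinarith [sq_nonneg (supn (pdx u) t - 1)]
    rw [integral_add intervalIntegrable_const
      ((by fun_prop : Continuous fun t => supn (pdx u) t ^ 2).intervalIntegrable _ _),
      intervalIntegral.integral_const] at e1
    simp only [sub_zero, smul_eq_mul, mul_one] at e1
    linarith
  have s0 := cont_slice cσ 0
  have hFc : ∀ t ∈ Icc (0:ℝ) T, Continuous fun x => PhiQ q (σ t x) / affc μp μm (c t x) := by
    intro t ht
    have h1 := cont_slice cσ t
    have h2 := cont_slice hc.continuous t
    apply Continuous.div (by fun_prop) _ (fun x => (hm1.trans_le (hμ1 t ht x)).ne')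
    unfold affc; fun_prop
  have hy0 : ∫ x in (0:ℝ)..1, PhiQ q (σ 0 x) / affc μp μm (c 0 x)
      ≤ 1 / m1 * (2 ^ (q / 2) * (1 + S)) := by
    have cp : Continuous fun x => |σ 0 x| ^ q :=
      s0.abs.rpow_const fun x => Or.inr (by linarith)
    have e1 : ∫ x in (0:ℝ)..1, PhiQ q (σ 0 x) / affc μp μm (c 0 x)
        ≤ ∫ x in (0:ℝ)..1, 1 / m1 * (2 ^ (q / 2) * (1 + |σ 0 x| ^ q)) := by
      apply integral_mono_on zero_le_one ((hFc 0 h0T).intervalIntegrable _ _)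
      · exact (by fun_prop : Continuous fun x =>
          1 / m1 * (2 ^ (q / 2) * (1 + |σ 0 x| ^ q))).intervalIntegrable _ _
      · intro x _
        rw [one_div_mul_eq_div]
        have := hμ1 0 h0T x
        have := PhiQ_pos q (σ 0 x)
        exact div_le_div₀ (by positivity) (PhiQ_le hq _) hm1 (hμ1 0 h0T x)
    rw [intervalIntegral.integral_const_mul, intervalIntegral.integral_const_mul,
      integral_add intervalIntegrable_const (cp.intervalIntegrable _ _), hS,
      intervalIntegral.integral_const] at e1
    simpa using e1
  have hy00 : 0 ≤ ∫ x in (0:ℝ)..1, PhiQ q (σ 0 x) / affc μp μm (c 0 x) := by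
    apply intervalIntegral.integral_nonneg zero_le_one
    intro x _
    have := PhiQ_pos q (σ 0 x)
    have : 0 < affc μp μm (c 0 x) := hm1.trans_le (hμ1 0 h0T x)
    positivity
  have hZle : (∫ x in (0:ℝ)..1, PhiQ q (σ 0 x) / affc μp μm (c 0 x)) *
        Real.exp ((1 + κm * q) * ∫ s in (0:ℝ)..T, supn (pdx u) s) ≤ Z := by
    rw [hZ]
    apply mul_le_mul hy0 _ (Real.exp_pos _).le (hy00.trans hy0)
    apply Real.exp_le_exp.2
    gcongr
  have hYle : ∀ t ∈ Icc (0:ℝ) T, ∫ x in (0:ℝ)..1, PhiQ q (σ t x) ≤ Y := by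
    intro t ht
    have s1 := cont_slice cσ t
    have e1 : ∫ x in (0:ℝ)..1, PhiQ q (σ t x) ≤
        ∫ x in (0:ℝ)..1, m2 * (PhiQ q (σ t x) / affc μp μm (c t x)) := by
      apply integral_mono_on zero_le_one
      · exact (by fun_prop : Continuous fun x => PhiQ q (σ t x)).intervalIntegrable _ _
      · exact ((hFc t ht).intervalIntegrable _ _).const_mul _
      · intro x _
        have p1 : 0 < affc μp μm (c t x) := hm1.trans_le (hμ1 t ht x)
        have p2 := (haff μp μm t ht x).2
        have p3 := PhiQ_pos q (σ t x)
        rw [← mul_div_assoc, le_div_iff₀ p1, mul_comm]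
        gcongr
    rw [intervalIntegral.integral_const_mul] at e1
    exact e1.trans (mul_le_mul_of_nonneg_left ((en1 t ht).trans hZle) hm2.le)
  have cD : Continuous (uncurry fun t x => PsiQ q (σ t x) * pdx σ t x ^ 2) := by
    have e : (uncurry fun t x => PsiQ q (σ t x) * pdx σ t x ^ 2)
      = fun p => PsiQ q (uncurry σ p) * uncurry (pdx σ) p ^ 2 := by
      ext ⟨t, x⟩; rfl
    rw [e]; fun_prop
  have cA : Continuous (uncurry fun t x => pdx σ t x ^ 2) := cσx.pow 2
  have cB : Continuous (uncurry fun t x => (pdt σ t x + u t x * pdx σ t x) ^ 2) :=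
    (cσt.add (cu.mul cσx)).pow 2
  have cW : Continuous (uncurry fun t x => 1 + σ t x ^ 2) := continuous_const.add (cσ.pow 2)
  have hsq : ∀ t, 0 ≤ ∫ x in (0:ℝ)..1, σ t x ^ 2 := fun t =>
    intervalIntegral.integral_nonneg zero_le_one fun x _ => sq_nonneg _
  have hA0 : ∀ t, 0 ≤ ∫ x in (0:ℝ)..1, pdx σ t x ^ 2 := fun t =>
    intervalIntegral.integral_nonneg zero_le_one fun x _ => sq_nonneg _
  have hAA : 0 ≤ ∫ s in (0:ℝ)..T, ∫ x in (0:ℝ)..1, pdx σ s x ^ 2 :=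
    intervalIntegral.integral_nonneg hT.le fun s _ => hA0 s
  have hfin : ∫ t in (0:ℝ)..T, supn (pdx σ) t * √(supn (fun s y => 1 + σ s y ^ 2) t) ≤ C0 := by
    rw [hC0]
    refine final_time (a := supn (pdx u)) hT hq (supn_cont cσx) (supn_cont cW) (cont_int cA)
      (cont_int cB) ca (cont_int cD) (by positivity) (by positivity) (by positivity)
      (fun t _ => supn_nonneg t) ?_ ?_ ?_ ?_ ?_ h9' ?_
    · exact fun t => intervalIntegral.integral_nonneg zero_le_one fun x _ => sq_nonneg _
    · intro t ht l hl
      exact sup_dx (μ := fun x => affc μp μm (c t x)) (ρ := ρ) (v := v) (κ := κ) t hσ hu hv (pσ t)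
        hm1 hρlo hκm (hμ1 t ht) (hρ' t ht) (hκ t ht) (hMom t ht) (hst t ht)
        (by have := h5 t ht; linarith) l hl
    · intro t ht
      exact sup_q hq hσ t (hYle t ht)
    · have := h5 0 h0T
      have := hsq 0
      linarith
    · have e1 := h11 T hTT
      have e2 : 0 ≤ min 1 T * ∫ x in (0:ℝ)..1, pdx σ T x ^ 2 :=
        mul_nonneg (le_min zero_le_one hT.le) (hA0 T)
      linarith
    · rw [hCD, le_div_iff₀ (by positivity), mul_comm]
      exact en2.trans hZle
  have cMW : Continuous fun t => supn (pdx σ) t * √(supn (fun s y => 1 + σ s y ^ 2) t) :=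
    (supn_cont cσx).mul (supn_cont cW).sqrt
  have hW1 : ∀ t, ∀ x ∈ Icc (0:ℝ) 1, 1 + σ t x ^ 2 ≤ supn (fun s y => 1 + σ s y ^ 2) t :=
    fun t x hx => (le_abs_self _).trans (le_supn cW t hx)
  have hfin2 : ∫ t in (0:ℝ)..T, 2 * (supn (pdx σ) t * √(supn (fun s y => 1 + σ s y ^ 2) t))
      ≤ 2 * C0 := by
    rw [intervalIntegral.integral_const_mul]; linarith
  have i2 := (cMW.const_mul 2).intervalIntegrable (μ := volume) 0 T
  constructor
  · refine le_trans ?_ (hfin2.trans (le_max_right _ _))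
    change ∫ t in (0:ℝ)..T, supn (pdx σ) t ≤ _
    apply integral_mono_on hT.le ((supn_cont cσx).intervalIntegrable _ _) i2
    intro t _
    have h1 : 1 ≤ √(supn (fun s y => 1 + σ s y ^ 2) t) := by
      rw [Real.one_le_sqrt]
      have := hW1 t 0 (by simp)
      nlinarith [sq_nonneg (σ t 0)]
    have h2 : 0 ≤ supn (pdx σ) t := supn_nonneg t
    nlinarith
  · refine le_trans ?_ (hfin2.trans (le_max_right _ _))
    have e : pdx (fun s y => σ s y ^ 2) = fun t x => 2 * σ t x * pdx σ t x := by
      ext t x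
      have := ((hdx hσ t x).pow 2).deriv
      refine Eq.trans ?_ (this.trans ?_)
      · rfl
      · simp
    change ∫ t in (0:ℝ)..T, supn (pdx (fun s y => σ s y ^ 2)) t ≤ _
    rw [e]
    have cE : Continuous (uncurry fun t x => 2 * σ t x * pdx σ t x) :=
      (continuous_const.mul cσ).mul cσx
    apply integral_mono_on hT.le ((supn_cont cE).intervalIntegrable _ _) i2
    intro t _
    apply supn_le
    intro x hx
    have h1 : |σ t x| ≤ √(supn (fun s y => 1 + σ s y ^ 2) t) := by
      apply Real.abs_le_sqrt
      linarith [hW1 t x hx]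
    have h2 := le_supn cσx t hx
    rw [abs_mul, abs_mul, abs_of_pos (by norm_num : (0:ℝ) < 2), mul_assoc,
      mul_comm (supn (pdx σ) t)]
    gcongr
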